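/- Let q be a prime power, m ≥ 1, and let C = C_A be a weighted Reed-Muller code, i.e., A = {(i_1,…,i_m) ∈ [0,q−1]^m : s_1 i_1 + ⋯ + s_m i_m ≤ s} for some real weights s_1,…,s_m > 0 and s > 0. Then the minimum distance of the square code C^{(2)} = C_{A+A} equals min_{(α_1,…,α_m) ∈ (A+A)_q} (q−α_1)⋯(q−α_m), i.e., the minimum distance of the square of a weighted Reed-Muller code attains its footprint bound. -/

import Mathlib

/-- The affine code `C_A`: evaluations at all points of `F^m` of polynomials whose
monomial support lies in `A`. -/
noncomputable def affineCode (F : Type) [Field F] [Fintype F] (m : ℕ)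
    (A : Set (Fin m → ℕ)) : Set ((Fin m → F) → F) :=
  {v | ∃ f : MvPolynomial (Fin m) F,
        (∀ d ∈ f.support, (d : Fin m → ℕ) ∈ A) ∧ v = fun P => MvPolynomial.eval P f}

/-- The square code `C^{(2)}`: the span of all componentwise (Schur) products of
pairs of codewords of `C`. -/
noncomputable def squareCode (F : Type) [Field F] {n : Type} (C : Set (n → F)) :
    Set (n → F) :=
  (Submodule.span F {v | ∃ c₁ ∈ C, ∃ c₂ ∈ C, v = c₁ * c₂} : Submodule F (n → F))

/-- The minimum distance of a code: the minimum Hamming weight of a nonzero codeword. -/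
noncomputable def minDist (F : Type) [Field F] [Fintype F] [DecidableEq F] {m : ℕ}
    (C : Set ((Fin m → F) → F)) : ℕ :=
  sInf {w | ∃ v ∈ C, v ≠ 0 ∧ hammingNorm v = w}

/-- Reduction `[b]_q` of an integer `b ∈ [0, 2q−2]`: `b` itself if `b ≤ q−1`, and
`b − (q−1)` otherwise. -/
def redq (q b : ℕ) : ℕ := if b ≤ q - 1 then b else b - (q - 1)

section FootprintBound

open Finset MvPolynomial

lemma redq_le_self (q b : ℕ) : redq q b ≤ b := by
  unfold redq; split_ifs <;> omega

lemma redq_lt {q b : ℕ} (hq : 0 < q) (hb : b ≤ 2 * (q - 1)) : redq q b < q := by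
  unfold redq; split_ifs <;> omega

lemma pow_redq {F : Type*} [Field F] [Fintype F] (x : F) (b : ℕ) :
    x ^ redq (Fintype.card F) b = x ^ b := by
  unfold redq
  split_ifs with h
  · rfl
  · have hq : 0 < Fintype.card F := Fintype.card_pos
    obtain ⟨k, rfl⟩ := Nat.exists_eq_add_of_le (show Fintype.card F ≤ b by omega)
    rw [pow_add, FiniteField.pow_card, ← pow_succ']
    congr 1
    omega

lemma card_sub_natDegree_le_card_eval_ne_zero {F : Type*} [Field F] [Fintype F] [DecidableEq F]
    {p : Polynomial F} (hp : p ≠ 0) :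
    Fintype.card F - p.natDegree ≤ #{x : F | p.eval x ≠ 0} := by
  have hroots : #{x : F | p.eval x = 0} ≤ p.natDegree := by
    refine le_trans (card_le_card fun x hx => ?_)
      (p.roots.toFinset_card_le.trans p.card_roots')
    simpa [hp] using hx
  have hsplit := card_filter_add_card_filter_not (s := (univ : Finset F)) (fun x => p.eval x = 0)
  rw [card_univ] at hsplit
  simp only [ne_eq]
  omega

/-- The footprint bound: the number of points where a nonzero polynomial does not vanish is at
least `∏ i, (q - α i)` for some exponent `α` in its support. -/
lemma exists_mem_support_prod_card_sub_le {F : Type*} [Field F] [Fintype F] [DecidableEq F] :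
    ∀ {n : ℕ} {g : MvPolynomial (Fin n) F}, g ≠ 0 → ∃ α ∈ g.support,
      ∏ i, (Fintype.card F - α i) ≤ #{x : Fin n → F | eval x g ≠ 0}
  | 0, g, hg => by
    obtain ⟨α, hα⟩ := support_nonempty.mpr hg
    refine ⟨α, hα, ?_⟩
    obtain ⟨c, rfl⟩ := C_surjective (Fin 0) g
    have hc : c ≠ 0 := by rintro rfl; simp at hg
    simp [hc]
  | n + 1, g, hg => by
    set p := finSuccEquiv F n g with hp
    have hp0 : p ≠ 0 := by simpa [hp] using hg
    obtain ⟨β, hβ, hle⟩ :=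
      exists_mem_support_prod_card_sub_le (Polynomial.leadingCoeff_ne_zero.mpr hp0)
    refine ⟨β.cons p.natDegree, mem_support_coeff_finSuccEquiv.mp hβ, ?_⟩
    set U : Finset (Fin n → F) := {y | eval y p.leadingCoeff ≠ 0}
    let V : (Fin n → F) → Finset F := fun y => {x | (p.map (eval y)).eval x ≠ 0}
    have hV : ∀ y ∈ U, Fintype.card F - p.natDegree ≤ #(V y) := fun y hy => by
      have hy : eval y p.leadingCoeff ≠ 0 := by simpa [U] using hy
      have hne : p.map (eval y) ≠ 0 := fun h => hy <| by
        simpa using congrArg (Polynomial.coeff · p.natDegree) h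
      rw [← Polynomial.natDegree_map_of_leadingCoeff_ne_zero (eval y) hy]
      exact card_sub_natDegree_le_card_eval_ne_zero hne
    calc ∏ i, (Fintype.card F - β.cons p.natDegree i)
        = (∏ i, (Fintype.card F - β i)) * (Fintype.card F - p.natDegree) := by
          rw [Fin.prod_univ_succ, mul_comm]; simp
      _ ≤ #U * (Fintype.card F - p.natDegree) := Nat.mul_le_mul_right _ hle
      _ ≤ ∑ y ∈ U, #(V y) := by
          rw [← smul_eq_mul]; exact card_nsmul_le_sum _ _ _ hV
      _ = #(U.sigma V) := (card_sigma _ _).symm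
      _ ≤ _ := by
          refine card_le_card_of_injOn (fun z => Fin.cons z.2 z.1) ?_ ?_
          · rintro ⟨y, x⟩ hz
            have hx : (p.map (eval y)).eval x ≠ 0 := by
              simpa [V] using (mem_sigma.mp hz).2
            simpa [eval_eq_eval_mv_eval'] using hx
          · rintro ⟨y, x⟩ - ⟨y', x'⟩ - h
            obtain ⟨rfl, rfl⟩ := Fin.cons_inj.mp h
            rfl

/-- Any codeword of the square code of `C_A` is the evaluation of a polynomial supported on the
reduced exponents `(A + A)_q`. -/
lemma exists_eval_eq_of_mem_squareCode {F : Type} [Field F] [Fintype F] {m : ℕ}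
    {A : Set (Fin m → ℕ)} {v : (Fin m → F) → F} (hv : v ∈ squareCode F (affineCode F m A)) :
    ∃ f : MvPolynomial (Fin m) F,
      (∀ d ∈ f.support, ∃ a ∈ A, ∃ b ∈ A, ∀ i, d i = redq (Fintype.card F) (a i + b i)) ∧
      v = fun P => eval P f := by
  set B : Set (Fin m →₀ ℕ) :=
    {d | ∃ a ∈ A, ∃ b ∈ A, ∀ i, d i = redq (Fintype.card F) (a i + b i)}
  let ev : MvPolynomial (Fin m) F →ₗ[F] ((Fin m → F) → F) :=
    LinearMap.pi fun P => (aeval P).toLinearMap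
  suffices h : v ∈ (restrictSupport F B).map ev by
    obtain ⟨f, hf, rfl⟩ := h
    refine ⟨f, fun d hd => (mem_restrictSupport_iff F).mp hf hd, ?_⟩
    ext P
    simp [ev, aeval_eq_eval]
  refine Submodule.span_le.mpr ?_ hv
  rintro _ ⟨_, ⟨f, hf, rfl⟩, _, ⟨g, hg, rfl⟩, rfl⟩
  have hfg : ((fun P => eval P f) * fun P => eval P g : (Fin m → F) → F) =
      ∑ a ∈ f.support, ∑ b ∈ g.support, (f.coeff a * g.coeff b) •
        fun P => ∏ i, P i ^ (a i + b i) := by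
    ext P
    simp only [Pi.mul_apply, eval_eq' P f, eval_eq' P g, sum_mul_sum, Finset.sum_apply,
      Pi.smul_apply, smul_eq_mul, pow_add, prod_mul_distrib]
    exact sum_congr rfl fun a _ => sum_congr rfl fun b _ => by ring
  rw [hfg]
  refine sum_mem fun a ha => sum_mem fun b hb => Submodule.smul_mem _ _ ?_
  refine ⟨monomial (Finsupp.equivFunOnFinite.symm
    fun i => redq (Fintype.card F) (a i + b i)) 1, ?_, ?_⟩
  · refine (mem_restrictSupport_iff F).mpr fun d hd => ?_
    obtain rfl := mem_singleton.mp (support_monomial_subset hd)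
    exact ⟨a, hf a ha, b, hg b hb, fun i => rfl⟩
  · ext P
    simp [ev, aeval_monomial, Finsupp.prod_fintype, pow_redq]

/-- The product of the linear factors `X i - c` with `c ∈ T i`. -/
noncomputable def gridPolynomial {F : Type*} [Field F] {m : ℕ} (T : Fin m → Finset F) :
    MvPolynomial (Fin m) F :=
  ∏ i, ∏ c ∈ T i, (X i - C c)

lemma eval_gridPolynomial_ne_zero_iff {F : Type*} [Field F] {m : ℕ} (T : Fin m → Finset F)
    (P : Fin m → F) : eval P (gridPolynomial T) ≠ 0 ↔ ∀ i, P i ∉ T i := by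
  simp only [gridPolynomial, map_prod, map_sub, eval_X, eval_C, prod_ne_zero_iff, mem_univ,
    true_imp_iff, sub_ne_zero]
  exact forall_congr' fun i => ⟨fun h hi => h _ hi rfl, fun h c hc e => h (e ▸ hc)⟩

lemma degreeOf_gridPolynomial_le {F : Type*} [Field F] {m : ℕ} (T : Fin m → Finset F)
    (i : Fin m) : degreeOf i (gridPolynomial T) ≤ #(T i) := by
  have hfactor (j : Fin m) (c : F) :
      degreeOf i (X j - C c : MvPolynomial (Fin m) F) ≤ if j = i then 1 else 0 := by
    refine (degreeOf_sub_le _ _ _).trans ?_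
    simp [degreeOf_X, degreeOf_C, eq_comm]
  calc degreeOf i (gridPolynomial T)
      ≤ ∑ j, degreeOf i (∏ c ∈ T j, (X j - C c) : MvPolynomial (Fin m) F) :=
        degreeOf_prod_le _ _ _
    _ ≤ ∑ j, ∑ c ∈ T j, if j = i then 1 else 0 :=
        sum_le_sum fun j _ => (degreeOf_prod_le _ _ _).trans
          (sum_le_sum fun c _ => hfactor j c)
    _ = #(T i) := by simp

lemma eval_gridPolynomial_mem_affineCode {F : Type} [Field F] [Fintype F] {m : ℕ}
    {A : Set (Fin m → ℕ)} (hA : IsLowerSet A) {a : Fin m → ℕ} (ha : a ∈ A)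
    (T : Fin m → Finset F) (hT : ∀ i, #(T i) ≤ a i) :
    (fun P => eval P (gridPolynomial T)) ∈ affineCode F m A :=
  ⟨_, fun _ hd => hA (fun i => (monomial_le_degreeOf i hd).trans
    ((degreeOf_gridPolynomial_le T i).trans (hT i))) ha, rfl⟩

lemma exists_card_union_eq {F : Type*} [Fintype F] [DecidableEq F] {a b r : ℕ}
    (hr : r ≤ Fintype.card F) (hab : r ≤ a + b) :
    ∃ S T : Finset F, #S ≤ a ∧ #T ≤ b ∧ #(S ∪ T) = r := by
  obtain ⟨U, -, hU⟩ := exists_subset_card_eq (s := (univ : Finset F)) (by simpa using hr)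
  obtain ⟨S, hSU, hS⟩ := exists_subset_card_eq (s := U) (n := min a r) (by omega)
  refine ⟨S, U \ S, by omega, ?_, by rw [union_sdiff_of_subset hSU, hU]⟩
  rw [card_sdiff_of_subset hSU]
  omega

/-- For a downward closed exponent set, every reduced exponent in `(A + A)_q` is realised by a
codeword of the square code whose weight is given by the footprint. -/
lemma exists_mem_squareCode_hammingNorm_eq {F : Type} [Field F] [Fintype F] [DecidableEq F]
    {m : ℕ} {A : Set (Fin m → ℕ)} (hA : IsLowerSet A)
    (hAq : ∀ a ∈ A, ∀ i, a i ≤ Fintype.card F - 1) {a b : Fin m → ℕ} (ha : a ∈ A) (hb : b ∈ A) :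
    ∃ v ∈ squareCode F (affineCode F m A), v ≠ 0 ∧
      hammingNorm v = ∏ i, (Fintype.card F - redq (Fintype.card F) (a i + b i)) := by
  have hlt (i : Fin m) : redq (Fintype.card F) (a i + b i) < Fintype.card F :=
    redq_lt Fintype.card_pos (by have := hAq a ha i; have := hAq b hb i; omega)
  choose S T hS hT hST using fun i =>
    exists_card_union_eq (F := F) (hlt i).le (redq_le_self _ (a i + b i))
  set v : (Fin m → F) → F :=
    (fun P => eval P (gridPolynomial S)) * fun P => eval P (gridPolynomial T) with hvdef
  have hnorm : hammingNorm v =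
      ∏ i, (Fintype.card F - redq (Fintype.card F) (a i + b i)) := by
    have hsupp : ({P | v P ≠ 0} : Finset (Fin m → F)) =
        Fintype.piFinset fun i => (S i ∪ T i)ᶜ := by
      ext P
      rw [mem_filter, hvdef, Pi.mul_apply, mul_ne_zero_iff, eval_gridPolynomial_ne_zero_iff,
        eval_gridPolynomial_ne_zero_iff]
      simp [forall_and]
    rw [hammingNorm, hsupp, Fintype.card_piFinset]
    simp only [card_compl, hST]
  refine ⟨v, Submodule.subset_span ⟨_, eval_gridPolynomial_mem_affineCode hA ha S hS, _,
    eval_gridPolynomial_mem_affineCode hA hb T hT, rfl⟩, ?_, hnorm⟩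
  rw [← hammingNorm_pos_iff, hnorm]
  exact prod_pos fun i _ => Nat.sub_pos_of_lt (hlt i)

/-- The square of an affine code with downward closed exponent set attains its footprint
bound. -/
lemma minDist_squareCode_of_isLowerSet {F : Type} [Field F] [Fintype F] [DecidableEq F]
    {m : ℕ} {A : Set (Fin m → ℕ)} (hA : IsLowerSet A) (hne : A.Nonempty)
    (hAq : ∀ a ∈ A, ∀ i, a i ≤ Fintype.card F - 1) :
    minDist F (squareCode F (affineCode F m A)) =
      sInf {w : ℕ | ∃ a ∈ A, ∃ b ∈ A,
        w = ∏ i, (Fintype.card F - redq (Fintype.card F) (a i + b i))} := by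
  obtain ⟨a₀, ha₀⟩ := hne
  have hattained {a b : Fin m → ℕ} (ha : a ∈ A) (hb : b ∈ A) :=
    exists_mem_squareCode_hammingNorm_eq hA hAq ha hb
  apply le_antisymm
  · refine le_csInf ⟨_, a₀, ha₀, a₀, ha₀, rfl⟩ ?_
    rintro _ ⟨a, ha, b, hb, rfl⟩
    exact Nat.sInf_le (hattained ha hb)
  · refine le_csInf ⟨_, hattained ha₀ ha₀⟩ ?_
    rintro _ ⟨v, hv, hv0, rfl⟩
    obtain ⟨f, hf, rfl⟩ := exists_eval_eq_of_mem_squareCode hv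
    have hf0 : f ≠ 0 := by rintro rfl; exact hv0 (by ext; simp)
    obtain ⟨α, hα, hle⟩ := exists_mem_support_prod_card_sub_le hf0
    obtain ⟨a, ha, b, hb, hab⟩ := hf α hα
    refine le_trans (Nat.sInf_le ?_) hle
    exact ⟨a, ha, b, hb, by simp only [hab]⟩

end FootprintBound

theorem stmt11 (F : Type) [Field F] [Fintype F] [DecidableEq F]
    (m : ℕ) (hm : 1 ≤ m)
    (s : Fin m → ℝ) (hs : ∀ i, 0 < s i) (lam : ℝ) (hlam : 0 < lam)
    -- the weighted Reed-Muller exponent set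
    (A : Set (Fin m → ℕ))
    (hA : A = {a : Fin m → ℕ | (∀ i, a i ≤ Fintype.card F - 1) ∧
        ∑ i, s i * (a i : ℝ) ≤ lam}) :
    minDist F (squareCode F (affineCode F m A)) =
      sInf {w : ℕ | ∃ a ∈ A, ∃ b ∈ A,
        w = ∏ i, (Fintype.card F - redq (Fintype.card F) (a i + b i))} := by
  subst hA
  refine minDist_squareCode_of_isLowerSet ?_ ⟨0, by simp, by simpa using hlam.le⟩ fun a ha => ha.1
  rintro a b hba ⟨ha, hsum⟩
  refine ⟨fun i => (hba i).trans (ha i), (Finset.sum_le_sum fun i _ => ?_).trans hsum⟩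
  exact mul_le_mul_of_nonneg_left (Nat.cast_le.mpr (hba i)) (hs i).le
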